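/- Let n ≥ 1, T > 0, let D be a real diagonal n×n matrix, and suppose Σ_T is reachable from Σ₀ ∈ S⁺⁺ⁿ under isospectral control with spectrum D in time T. Then log λ(Σ_T) ≺ log λ(Σ₀)↓ + 2T·λ(D)↓, i.e., the vector of logarithms of the eigenvalues of Σ_T is majorized by the vector obtained by adding, entrywise, the decreasingly sorted vector of logarithms of the eigenvalues of Σ₀ and 2T times the decreasingly sorted vector of diagonal entries of D. -/

import Mathlib

open MeasureTheory Matrix

/-- The entries of `v` sorted in decreasing order. -/
noncomputable def sortDesc {n : ℕ} (v : Fin n → ℝ) : Fin n → ℝ :=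
  fun i => v (Tuple.sort v i.rev)

/-- `x` is majorized by `y`. -/
def IsMajorizedBy {n : ℕ} (x y : Fin n → ℝ) : Prop :=
  (∑ i, x i = ∑ i, y i) ∧
  ∀ k : ℕ, k < n →
    ∑ i ∈ Finset.univ.filter (fun i : Fin n => (i : ℕ) < k), sortDesc x i ≤
    ∑ i ∈ Finset.univ.filter (fun i : Fin n => (i : ℕ) < k), sortDesc y i

/-- `ΣT` is reachable from `Σ₀` under isospectral control with spectrum `D` in time `T`. -/
noncomputable def IsReachable {n : ℕ} (P₀ PT D : Matrix (Fin n) (Fin n) ℝ) (T : ℝ) : Prop :=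
  ∃ U S : ℝ → Matrix (Fin n) (Fin n) ℝ,
    (∀ i j, Measurable fun t => U t i j) ∧
    (∀ t ∈ Set.Icc (0:ℝ) T, U t * (U t)ᵀ = 1) ∧
    (∀ t ∈ Set.Icc (0:ℝ) T, (S t).PosDef) ∧
    S 0 = P₀ ∧ S T = PT ∧
    (∀ i j, IntervalIntegrable
        (fun t => ((U t * D * (U t)ᵀ) * S t + S t * (U t * D * (U t)ᵀ)) i j)
        MeasureTheory.volume 0 T) ∧
    (∀ t ∈ Set.Icc (0:ℝ) T, ∀ i j,
      S t i j = P₀ i j +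
        ∫ s in (0:ℝ)..t, ((U s * D * (U s)ᵀ) * S s + S s * (U s * D * (U s)ᵀ)) i j)
section Majorization

/-- The sum of the `k` largest entries of `x`. -/
noncomputable def topSum {n : ℕ} (k : ℕ) (x : Fin n → ℝ) : ℝ :=
  ∑ i ∈ Finset.univ.filter (fun i : Fin n => (i : ℕ) < k), sortDesc x i

/-- The permutation that sorts the entries of `x` in decreasing order. -/
noncomputable def sortDescPerm {n : ℕ} (x : Fin n → ℝ) : Equiv.Perm (Fin n) :=
  Fin.revPerm.trans (Tuple.sort x)

theorem sortDesc_apply {n : ℕ} (x : Fin n → ℝ) (i : Fin n) :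
    sortDesc x i = x (sortDescPerm x i) := rfl

theorem sortDesc_antitone {n : ℕ} (x : Fin n → ℝ) : Antitone (sortDesc x) := fun _ _ hij =>
  Tuple.monotone_sort x (Fin.rev_le_rev.mpr hij)

theorem sum_sortDesc {n : ℕ} (x : Fin n → ℝ) : ∑ i, sortDesc x i = ∑ i, x i :=
  Equiv.sum_comp (sortDescPerm x) x

theorem card_filter_val_lt {n k : ℕ} (hk : k ≤ n) :
    (Finset.univ.filter (fun i : Fin n => (i : ℕ) < k)).card = k := by
  rw [Fin.card_filter_val_lt, min_eq_right hk]

theorem topSum_self {n : ℕ} (x : Fin n → ℝ) : topSum n x = ∑ i, x i := by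
  simp [topSum, sum_sortDesc]

theorem exists_finset_sum_eq_topSum {n k : ℕ} (hk : k ≤ n) (x : Fin n → ℝ) :
    ∃ I : Finset (Fin n), I.card = k ∧ ∑ i ∈ I, x i = topSum k x := by
  refine ⟨(Finset.univ.filter (fun i : Fin n => (i : ℕ) < k)).map (sortDescPerm x).toEmbedding,
    ?_, ?_⟩
  · rw [Finset.card_map, card_filter_val_lt hk]
  · rw [Finset.sum_map]
    rfl

theorem sum_mul_le_topSum {n k : ℕ} (hk : k ≤ n) (q d : Fin n → ℝ) (h0 : ∀ i, 0 ≤ q i)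
    (h1 : ∀ i, q i ≤ 1) (hq : ∑ i, q i = k) : ∑ i, q i * d i ≤ topSum k d := by
  rcases Nat.eq_zero_or_pos k with rfl | hk0
  · have hz : ∀ i, q i = 0 := by
      have := (Finset.sum_eq_zero_iff_of_nonneg (fun i _ => h0 i)).mp
        (hq.trans (by simp) : ∑ i, q i = 0)
      simpa using this
    simp [hz, topSum]
  · set c := sortDesc d ⟨k - 1, by omega⟩ with hc
    rw [← Equiv.sum_comp (sortDescPerm d) (fun i => q i * d i)]
    rw [← Equiv.sum_comp (sortDescPerm d) q] at hq
    have hcard : ∑ i : Fin n, (if (i : ℕ) < k then (1 : ℝ) else 0) = k := by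
      rw [← Finset.sum_filter, Finset.sum_const, card_filter_val_lt hk]
      simp
    have key : 0 ≤ ∑ i : Fin n, ((if (i : ℕ) < k then (1 : ℝ) else 0) - q (sortDescPerm d i)) *
        (sortDesc d i - c) := by
      refine Finset.sum_nonneg fun i _ => ?_
      split_ifs with h
      · refine mul_nonneg (by linarith [h1 (sortDescPerm d i)]) (sub_nonneg.mpr ?_)
        exact sortDesc_antitone d (Fin.le_def.mpr (by simp; omega))
      · refine mul_nonneg_of_nonpos_of_nonpos (by linarith [h0 (sortDescPerm d i)])
          (sub_nonpos.mpr ?_)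
        exact sortDesc_antitone d (Fin.le_def.mpr (by simp; omega))
    have expand : ∑ i : Fin n, ((if (i : ℕ) < k then (1 : ℝ) else 0) - q (sortDescPerm d i)) *
        (sortDesc d i - c) = topSum k d - ∑ i, q (sortDescPerm d i) * d (sortDescPerm d i)
          - c * (∑ i : Fin n, (if (i : ℕ) < k then (1 : ℝ) else 0)
            - ∑ i, q (sortDescPerm d i)) := by
      rw [topSum, Finset.sum_filter, ← Finset.sum_sub_distrib, ← Finset.sum_sub_distrib,
        Finset.mul_sum, ← Finset.sum_sub_distrib]
      refine Finset.sum_congr rfl fun i _ => ?_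
      rw [sortDesc_apply]
      split_ifs <;> ring
    rw [hcard, hq] at expand
    linarith

theorem sum_finset_le_topSum {n k : ℕ} (hk : k ≤ n) (x : Fin n → ℝ) {I : Finset (Fin n)}
    (hI : I.card = k) : ∑ i ∈ I, x i ≤ topSum k x := by
  have := sum_mul_le_topSum hk (fun i => if i ∈ I then 1 else 0) x
    (fun i => by split_ifs <;> norm_num)
    (fun i => by split_ifs <;> norm_num) (by simp [hI])
  simpa using this

end Majorization

section Spectral

open scoped Matrix.Norms.L2Operator

theorem trace_conj_diagonal_mul {n : ℕ} (V W : Matrix (Fin n) (Fin n) ℝ) (a b : Fin n → ℝ) :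
    trace (V * diagonal a * Vᵀ * (W * diagonal b * Wᵀ)) =
      ∑ i, ∑ j, a i * b j * ((Vᵀ * W) i j) ^ 2 := by
  have h1 : trace (V * diagonal a * Vᵀ * (W * diagonal b * Wᵀ)) =
      trace (diagonal a * (Vᵀ * W) * (diagonal b * (Vᵀ * W)ᵀ)) := by
    rw [transpose_mul, transpose_transpose]
    simp only [Matrix.mul_assoc]
    rw [Matrix.trace_mul_comm]
    simp only [Matrix.mul_assoc]
  rw [h1]
  generalize Vᵀ * W = O
  simp only [trace, diag_apply, mul_apply (M := diagonal a * O), diagonal_mul, transpose_apply]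
  refine Finset.sum_congr rfl fun i _ => Finset.sum_congr rfl fun j _ => ?_
  ring

theorem sum_sq_row {n : ℕ} {O : Matrix (Fin n) (Fin n) ℝ} (h : O * Oᵀ = 1) (i : Fin n) :
    ∑ j, (O i j) ^ 2 = 1 := by
  have := congrFun (congrFun h i) i
  simp only [mul_apply, transpose_apply, one_apply_eq] at this
  simpa only [sq] using this

theorem sum_sq_col {n : ℕ} {O : Matrix (Fin n) (Fin n) ℝ} (h : O * Oᵀ = 1) (j : Fin n) :
    ∑ i, (O i j) ^ 2 = 1 := by
  simpa using sum_sq_row (O := Oᵀ) (by rw [transpose_transpose]; exact mul_eq_one_comm.mp h) j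

theorem transpose_mul_orthogonal {n : ℕ} {V W : Matrix (Fin n) (Fin n) ℝ} (hV : V * Vᵀ = 1)
    (hW : W * Wᵀ = 1) : (Vᵀ * W) * (Vᵀ * W)ᵀ = 1 := by
  rw [transpose_mul, transpose_transpose, Matrix.mul_assoc, ← Matrix.mul_assoc W, hW,
    Matrix.one_mul, mul_eq_one_comm.mp hV]

/-- The orthogonal projection onto the span of the columns of `V` indexed by `I`, when `V` is
orthogonal. -/
noncomputable def spanProj {n : ℕ} (V : Matrix (Fin n) (Fin n) ℝ) (I : Finset (Fin n)) :
    Matrix (Fin n) (Fin n) ℝ :=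
  V * diagonal (fun i => if i ∈ I then 1 else 0) * Vᵀ

theorem sum_sq_mul_le_topSum {n k : ℕ} {O : Matrix (Fin n) (Fin n) ℝ} (hO : O * Oᵀ = 1)
    {I : Finset (Fin n)} (hI : I.card = k) (b : Fin n → ℝ) :
    ∑ i ∈ I, ∑ j, O i j ^ 2 * b j ≤ topSum k b := by
  have hk : k ≤ n := by simpa [hI] using I.card_le_univ
  rw [Finset.sum_comm]
  simp only [← Finset.sum_mul]
  refine sum_mul_le_topSum hk _ b (fun j => Finset.sum_nonneg fun i _ => sq_nonneg _)
    (fun j => ?_) ?_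
  · rw [← sum_sq_col hO j]
    exact Finset.sum_le_sum_of_subset_of_nonneg (Finset.subset_univ _) fun i _ _ => sq_nonneg _
  · rw [Finset.sum_comm]
    simp [sum_sq_row hO, hI]

theorem trace_spanProj_mul_le {n k : ℕ} {V W : Matrix (Fin n) (Fin n) ℝ} (hV : V * Vᵀ = 1)
    (hW : W * Wᵀ = 1) {I : Finset (Fin n)} (hI : I.card = k) (b : Fin n → ℝ) :
    trace (spanProj V I * (W * diagonal b * Wᵀ)) ≤ topSum k b := by
  rw [spanProj, trace_conj_diagonal_mul]
  refine le_trans (le_of_eq ?_) (sum_sq_mul_le_topSum (transpose_mul_orthogonal hV hW) hI b)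
  rw [← Finset.sum_filter_add_sum_filter_not Finset.univ (fun i => i ∈ I)]
  rw [Finset.sum_eq_zero (s := Finset.univ.filter (fun i => ¬ i ∈ I)), add_zero]
  · simp only [Finset.filter_mem_eq_inter, Finset.univ_inter]
    refine Finset.sum_congr rfl fun i hi => Finset.sum_congr rfl fun j _ => ?_
    rw [if_pos hi]
    ring
  · intro i hi
    simp [(Finset.mem_filter.mp hi).2]

theorem trace_spanProj {n : ℕ} {V : Matrix (Fin n) (Fin n) ℝ} (hV : V * Vᵀ = 1)
    (I : Finset (Fin n)) : trace (spanProj V I) = I.card := by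
  rw [spanProj, Matrix.trace_mul_comm, ← Matrix.mul_assoc, mul_eq_one_comm.mp hV, Matrix.one_mul,
    trace_diagonal]
  simp

theorem norm_le_one_of_mul_transpose {n : ℕ} {V : Matrix (Fin n) (Fin n) ℝ} (hV : V * Vᵀ = 1) :
    ‖V‖ ≤ 1 := by
  have h := CStarRing.norm_self_mul_star (x := V)
  rw [star_eq_conjTranspose, conjTranspose_eq_transpose_of_trivial, hV] at h
  have h1 : ‖(1 : Matrix (Fin n) (Fin n) ℝ)‖ ≤ 1 := by
    rw [← diagonal_one, l2_opNorm_diagonal]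
    exact (pi_norm_le_iff_of_nonneg zero_le_one).mpr fun i => by simp
  nlinarith [norm_nonneg V]

theorem norm_conj_le {n : ℕ} {V : Matrix (Fin n) (Fin n) ℝ} (hV : V * Vᵀ = 1)
    (M : Matrix (Fin n) (Fin n) ℝ) : ‖V * M * Vᵀ‖ ≤ ‖M‖ := by
  have hV' : ‖Vᵀ‖ ≤ 1 :=
    norm_le_one_of_mul_transpose (by rw [transpose_transpose]; exact mul_eq_one_comm.mp hV)
  calc ‖V * M * Vᵀ‖ ≤ ‖V‖ * ‖M‖ * ‖Vᵀ‖ :=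
        (norm_mul_le _ _).trans (by gcongr; exact norm_mul_le _ _)
    _ ≤ 1 * ‖M‖ * 1 := by gcongr; exact norm_le_one_of_mul_transpose hV
    _ = ‖M‖ := by ring

theorem norm_spanProj_le {n : ℕ} {V : Matrix (Fin n) (Fin n) ℝ} (hV : V * Vᵀ = 1)
    (I : Finset (Fin n)) : ‖spanProj V I‖ ≤ 1 := by
  refine (norm_conj_le hV _).trans ?_
  rw [l2_opNorm_diagonal]
  refine (pi_norm_le_iff_of_nonneg zero_le_one).mpr fun i => ?_
  split_ifs <;> simp

theorem exists_orthogonal_eq_conj_diagonal {n : ℕ} {M : Matrix (Fin n) (Fin n) ℝ}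
    (hM : M.IsHermitian) :
    ∃ V : Matrix (Fin n) (Fin n) ℝ, V * Vᵀ = 1 ∧ M = V * diagonal hM.eigenvalues * Vᵀ := by
  refine ⟨hM.eigenvectorUnitary, ?_, ?_⟩
  · have := (Unitary.mem_iff.mp hM.eigenvectorUnitary.2).2
    rwa [star_eq_conjTranspose, conjTranspose_eq_transpose_of_trivial] at this
  · have := hM.spectral_theorem
    rw [Unitary.conjStarAlgAut_apply, star_eq_conjTranspose,
      conjTranspose_eq_transpose_of_trivial] at this
    exact this

theorem conj_diagonal_mul {n : ℕ} {V : Matrix (Fin n) (Fin n) ℝ} (hV : V * Vᵀ = 1)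
    (a b : Fin n → ℝ) : (V * diagonal a * Vᵀ) * (V * diagonal b * Vᵀ) =
      V * diagonal (fun i => a i * b i) * Vᵀ := by
  rw [← diagonal_mul_diagonal]
  simp only [Matrix.mul_assoc]
  rw [← Matrix.mul_assoc Vᵀ V, mul_eq_one_comm.mp hV, Matrix.one_mul]

/-- The logarithms of the eigenvalues of a Hermitian matrix. -/
noncomputable def logEigenvalues {n : ℕ} (M : Matrix (Fin n) (Fin n) ℝ) : Fin n → ℝ :=
  open Classical in
  if h : M.IsHermitian then fun i => Real.log (h.eigenvalues i) else 0

theorem logEigenvalues_eq {n : ℕ} {M : Matrix (Fin n) (Fin n) ℝ} (h : M.IsHermitian) :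
    logEigenvalues M = fun i => Real.log (h.eigenvalues i) := dif_pos h

/-- A first order upper bound for the sum of the `k` largest logarithms of eigenvalues. -/
theorem exists_spanProj_topSum_log_le {n k : ℕ} (hk : k ≤ n) {M : Matrix (Fin n) (Fin n) ℝ}
    (hM : M.PosDef) :
    ∃ (V : Matrix (Fin n) (Fin n) ℝ) (I : Finset (Fin n)), V * Vᵀ = 1 ∧ I.card = k ∧
      M * spanProj V I = spanProj V I * M ∧
      ∀ N : Matrix (Fin n) (Fin n) ℝ, N.PosDef →
        topSum k (logEigenvalues M) - topSum k (logEigenvalues N) ≤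
          trace (spanProj V I * N⁻¹ * (M - N)) := by
  obtain ⟨V, hV, hMV⟩ := exists_orthogonal_eq_conj_diagonal hM.1
  obtain ⟨I, hI, hsum⟩ := exists_finset_sum_eq_topSum hk (logEigenvalues M)
  have hcomm : M * spanProj V I = spanProj V I * M := by
    rw [spanProj]
    nth_rewrite 1 [hMV]
    nth_rewrite 4 [hMV]
    rw [conj_diagonal_mul hV, conj_diagonal_mul hV]
    simp only [mul_comm]
  refine ⟨V, I, hV, hI, hcomm, fun N hN => ?_⟩
  obtain ⟨W, hW, hNW⟩ := exists_orthogonal_eq_conj_diagonal hN.1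
  have hO := transpose_mul_orthogonal hV hW
  have hMpos := hM.eigenvalues_pos
  have hNpos := hN.eigenvalues_pos
  have hNinv : N⁻¹ = W * diagonal (fun i => (hN.1.eigenvalues i)⁻¹) * Wᵀ := by
    refine inv_eq_right_inv ?_
    nth_rewrite 1 [hNW]
    rw [conj_diagonal_mul hW]
    simp [fun i => (hNpos i).ne', hW]
  have hNN : N⁻¹ * N = 1 := nonsing_inv_mul _ ((isUnit_iff_isUnit_det _).mp hN.isUnit)
  have htr : trace (spanProj V I * N⁻¹ * (M - N)) =
      ∑ i ∈ I, ∑ j, ((Vᵀ * W) i j) ^ 2 *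
        (hM.1.eigenvalues i * (hN.1.eigenvalues j)⁻¹ - 1) := by
    have h1 : trace (spanProj V I * N⁻¹ * (M - N)) =
        trace ((M * spanProj V I) * N⁻¹) - I.card := by
      rw [Matrix.mul_sub, trace_sub, Matrix.mul_assoc (spanProj V I) N⁻¹ N, hNN, Matrix.mul_one,
        trace_spanProj hV, Matrix.trace_mul_comm, Matrix.mul_assoc]
    have h2 : M * spanProj V I =
        V * diagonal (fun i => hM.1.eigenvalues i * if i ∈ I then 1 else 0) * Vᵀ := by
      rw [spanProj]
      nth_rewrite 1 [hMV]
      rw [conj_diagonal_mul hV]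
    have h3 : (I.card : ℝ) = ∑ i ∈ I, ∑ j, ((Vᵀ * W) i j) ^ 2 := by
      simp [sum_sq_row hO]
    rw [h1, h2, hNinv, trace_conj_diagonal_mul, h3]
    simp only [mul_sub, mul_one, Finset.sum_sub_distrib]
    congr 1
    rw [← Finset.sum_subset (Finset.subset_univ I)]
    · refine Finset.sum_congr rfl fun i hi => Finset.sum_congr rfl fun j _ => ?_
      rw [if_pos hi]
      ring
    · intro i _ hi
      simp [hi]
  rw [htr, ← hsum, logEigenvalues_eq hM.1]
  have hkf := sum_sq_mul_le_topSum hO hI (logEigenvalues N)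
  rw [logEigenvalues_eq hN.1] at hkf ⊢
  have hlog : ∑ i ∈ I, Real.log (hM.1.eigenvalues i) -
      ∑ i ∈ I, ∑ j, (Vᵀ * W) i j ^ 2 * Real.log (hN.1.eigenvalues j) ≤
      ∑ i ∈ I, ∑ j, ((Vᵀ * W) i j) ^ 2 *
        (hM.1.eigenvalues i * (hN.1.eigenvalues j)⁻¹ - 1) := by
    rw [← Finset.sum_sub_distrib]
    refine Finset.sum_le_sum fun i _ => ?_
    calc Real.log (hM.1.eigenvalues i) -
          ∑ j, (Vᵀ * W) i j ^ 2 * Real.log (hN.1.eigenvalues j)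
        = ∑ j, (Vᵀ * W) i j ^ 2 *
          (Real.log (hM.1.eigenvalues i) - Real.log (hN.1.eigenvalues j)) := by
          simp only [mul_sub, Finset.sum_sub_distrib, ← Finset.sum_mul]
          rw [sum_sq_row hO, one_mul]
      _ ≤ _ := by
          refine Finset.sum_le_sum fun j _ => mul_le_mul_of_nonneg_left ?_ (sq_nonneg _)
          rw [← Real.log_div (hMpos i).ne' (hNpos j).ne', ← div_eq_mul_inv]
          exact Real.log_le_sub_one_of_pos (div_pos (hMpos i) (hNpos j))
  linarith

end Spectral

section Flow

open scoped Matrix.Norms.L2Operator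

/-- The right-hand side `A S + S A` of the controlled equation, with `A = U D Uᵀ`. -/
noncomputable def controlledDrift {n : ℕ} (U S : ℝ → Matrix (Fin n) (Fin n) ℝ)
    (D : Matrix (Fin n) (Fin n) ℝ) (t : ℝ) : Matrix (Fin n) (Fin n) ℝ :=
  (U t * D * (U t)ᵀ) * S t + S t * (U t * D * (U t)ᵀ)

/-- `S` is a positive definite trajectory on `[0, T]` driven by the control `U` with
spectrum `D`. -/
structure IsControlledFlow {n : ℕ} (U S : ℝ → Matrix (Fin n) (Fin n) ℝ)
    (D : Matrix (Fin n) (Fin n) ℝ) (T : ℝ) : Prop where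
  orthogonal : ∀ t ∈ Set.Icc 0 T, U t * (U t)ᵀ = 1
  posDef : ∀ t ∈ Set.Icc 0 T, (S t).PosDef
  integrable : ∀ i j, IntervalIntegrable (fun t => controlledDrift U S D t i j) volume 0 T
  increment : ∀ s ∈ Set.Icc 0 T, ∀ t ∈ Set.Icc 0 T, ∀ i j,
    S t i j - S s i j = ∫ r in s..t, controlledDrift U S D r i j

theorem exists_abs_trace_le (n : ℕ) :
    ∃ c : ℝ, 0 ≤ c ∧ ∀ X : Matrix (Fin n) (Fin n) ℝ, |trace X| ≤ c * ‖X‖ :=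
  ⟨‖LinearMap.toContinuousLinearMap (traceLinearMap (Fin n) ℝ ℝ)‖,
    ContinuousLinearMap.opNorm_nonneg _,
    fun X => (LinearMap.toContinuousLinearMap (traceLinearMap (Fin n) ℝ ℝ)).le_opNorm X⟩

theorem trace_drift_le {n : ℕ} {c C η : ℝ} (hc : 0 ≤ c)
    (htr : ∀ X : Matrix (Fin n) (Fin n) ℝ, |trace X| ≤ c * ‖X‖)
    {M N R P A : Matrix (Fin n) (Fin n) ℝ} (hM : IsUnit M) (hN : IsUnit N)
    (hP : ‖P‖ ≤ 1) (hMP : M * P = P * M) (hR : ‖R‖ ≤ C) (hMi : ‖M⁻¹‖ ≤ C) (hNi : ‖N⁻¹‖ ≤ C)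
    (hRM : ‖R - M‖ ≤ η) (hRN : ‖R - N‖ ≤ η) (hNM : ‖N⁻¹ - M⁻¹‖ ≤ η) :
    trace (P * N⁻¹ * (A * R + R * A)) ≤ 2 * trace (P * A) + 3 * (c * C * ‖A‖) * η := by
  have hMM : M * M⁻¹ = 1 := mul_nonsing_inv _ ((isUnit_iff_isUnit_det _).mp hM)
  have hNN : N⁻¹ * N = 1 := nonsing_inv_mul _ ((isUnit_iff_isUnit_det _).mp hN)
  have hC : 0 ≤ C := (norm_nonneg _).trans hR
  have hη : 0 ≤ η := (norm_nonneg _).trans hRM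
  have h1 : trace (P * N⁻¹ * (A * R + R * A)) = 2 * trace (P * A) +
      trace ((R * P * (N⁻¹ - M⁻¹) + (R - M) * P * M⁻¹ + P * N⁻¹ * (R - N)) * A) := by
    have e1 : R * P * (N⁻¹ - M⁻¹) + (R - M) * P * M⁻¹ = R * P * N⁻¹ - P := by
      have : M * P * M⁻¹ = P := by rw [hMP, Matrix.mul_assoc, hMM, Matrix.mul_one]
      rw [Matrix.mul_sub, Matrix.sub_mul, Matrix.sub_mul, this]
      abel
    have e2 : P * N⁻¹ * (R - N) = P * N⁻¹ * R - P := by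
      rw [Matrix.mul_sub, Matrix.mul_assoc P N⁻¹ N, hNN, Matrix.mul_one]
    have e3 : trace (P * N⁻¹ * (A * R)) = trace (R * P * N⁻¹ * A) := by
      rw [← Matrix.mul_assoc, Matrix.trace_mul_comm]
      simp only [Matrix.mul_assoc]
    rw [e1, e2, Matrix.mul_add, trace_add, e3, Matrix.add_mul, Matrix.sub_mul, Matrix.sub_mul,
      trace_add, trace_sub, trace_sub, ← Matrix.mul_assoc (P * N⁻¹)]
    ring
  have b1 : ‖R * P * (N⁻¹ - M⁻¹)‖ ≤ C * 1 * η :=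
    (norm_mul_le _ _).trans (by gcongr; exact (norm_mul_le _ _).trans (by gcongr))
  have b2 : ‖(R - M) * P * M⁻¹‖ ≤ η * 1 * C :=
    (norm_mul_le _ _).trans (by gcongr; exact (norm_mul_le _ _).trans (by gcongr))
  have b3 : ‖P * N⁻¹ * (R - N)‖ ≤ 1 * C * η :=
    (norm_mul_le _ _).trans (by gcongr; exact (norm_mul_le _ _).trans (by gcongr))
  have h2 : ‖(R * P * (N⁻¹ - M⁻¹) + (R - M) * P * M⁻¹ + P * N⁻¹ * (R - N)) * A‖ ≤
      3 * C * η * ‖A‖ := by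
    refine (norm_mul_le _ _).trans ?_
    gcongr
    refine (norm_add_le _ _).trans ?_
    have := norm_add_le (R * P * (N⁻¹ - M⁻¹)) ((R - M) * P * M⁻¹)
    linarith
  have h3 := (le_abs_self _).trans (htr ((R * P * (N⁻¹ - M⁻¹) + (R - M) * P * M⁻¹ +
    P * N⁻¹ * (R - N)) * A))
  have h4 := mul_le_mul_of_nonneg_left h2 hc
  rw [h1]
  linarith

namespace IsControlledFlow

variable {n : ℕ} {U S : ℝ → Matrix (Fin n) (Fin n) ℝ} {D : Matrix (Fin n) (Fin n) ℝ} {T : ℝ}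

theorem continuousOn (h : IsControlledFlow U S D T) (hT : 0 ≤ T) :
    ContinuousOn S (Set.Icc 0 T) := by
  refine continuousOn_pi.mpr fun i => continuousOn_pi.mpr fun j => ?_
  have h0 : (0 : ℝ) ∈ Set.Icc 0 T := ⟨le_rfl, hT⟩
  have hc : ContinuousOn (fun t => ∫ r in (0 : ℝ)..t, controlledDrift U S D r i j)
      (Set.Icc 0 T) := by
    rw [← Set.uIcc_of_le hT]
    refine intervalIntegral.continuousOn_primitive_interval ?_
    rw [Set.uIcc_of_le hT]
    exact (intervalIntegrable_iff_integrableOn_Icc_of_le hT).mp (h.integrable i j)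
  refine (hc.add_const (S 0 i j)).congr fun t ht => ?_
  have := h.increment 0 h0 t ht i j
  dsimp only
  linarith

theorem continuousOn_inv (h : IsControlledFlow U S D T) (hT : 0 ≤ T) :
    ContinuousOn (fun t => (S t)⁻¹) (Set.Icc 0 T) := by
  intro t ht
  obtain ⟨u, hu⟩ := (h.posDef t ht).isUnit
  have hinv := NormedRing.inverse_continuousAt u
  rw [hu] at hinv
  simp only [nonsing_inv_eq_ringInverse]
  exact hinv.comp_continuousWithinAt (h.continuousOn hT t ht)

/-- Both the trajectory and its inverse are bounded and uniformly continuous. -/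
theorem exists_uniform_bounds (h : IsControlledFlow U S D T) (hT : 0 ≤ T) :
    ∃ C : ℝ, 0 ≤ C ∧ (∀ t ∈ Set.Icc 0 T, ‖S t‖ ≤ C ∧ ‖(S t)⁻¹‖ ≤ C) ∧
      ∀ η > 0, ∃ δ > 0, ∀ s ∈ Set.Icc 0 T, ∀ t ∈ Set.Icc 0 T, |s - t| < δ →
        ‖S s - S t‖ ≤ η ∧ ‖(S s)⁻¹ - (S t)⁻¹‖ ≤ η := by
  obtain ⟨C₁, hC₁⟩ := isCompact_Icc.exists_bound_of_continuousOn (h.continuousOn hT)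
  obtain ⟨C₂, hC₂⟩ := isCompact_Icc.exists_bound_of_continuousOn (h.continuousOn_inv hT)
  have u₁ := Metric.uniformContinuousOn_iff.mp
    (isCompact_Icc.uniformContinuousOn_of_continuous (h.continuousOn hT))
  have u₂ := Metric.uniformContinuousOn_iff.mp
    (isCompact_Icc.uniformContinuousOn_of_continuous (h.continuousOn_inv hT))
  refine ⟨max 0 (max C₁ C₂), le_max_left _ _, fun t ht => ⟨?_, ?_⟩, fun η hη => ?_⟩
  · exact (hC₁ t ht).trans ((le_max_left _ _).trans (le_max_right _ _))
  · exact (hC₂ t ht).trans ((le_max_right _ _).trans (le_max_right _ _))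
  · obtain ⟨δ₁, hδ₁, k₁⟩ := u₁ η hη
    obtain ⟨δ₂, hδ₂, k₂⟩ := u₂ η hη
    refine ⟨min δ₁ δ₂, lt_min hδ₁ hδ₂, fun s hs t ht hst => ⟨?_, ?_⟩⟩
    · rw [← dist_eq_norm]
      exact (k₁ s hs t ht (hst.trans_le (min_le_left _ _))).le
    · rw [← dist_eq_norm]
      exact (k₂ s hs t ht (hst.trans_le (min_le_right _ _))).le

theorem trace_mul_sub_le (h : IsControlledFlow U S D T) {s t : ℝ} (hs : s ∈ Set.Icc 0 T)
    (ht : t ∈ Set.Icc 0 T) (hst : s ≤ t) (X : Matrix (Fin n) (Fin n) ℝ) {b : ℝ}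
    (hb : ∀ r ∈ Set.Icc s t, trace (X * controlledDrift U S D r) ≤ b) :
    trace (X * (S t - S s)) ≤ b * (t - s) := by
  have hI : ∀ i j, IntervalIntegrable (fun r => controlledDrift U S D r i j) volume s t :=
    fun i j => (h.integrable i j).mono_set (by
      rw [Set.uIcc_of_le hst, Set.uIcc_of_le (hs.1.trans hs.2)]
      exact Set.Icc_subset_Icc hs.1 ht.2)
  have htr : ∀ Y : Matrix (Fin n) (Fin n) ℝ, trace (X * Y) = ∑ i, ∑ j, X i j * Y j i :=
    fun Y => by simp only [trace, diag_apply, mul_apply]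
  have hIj : ∀ i j, IntervalIntegrable (fun r => X i j * controlledDrift U S D r j i) volume s t :=
    fun i j => (hI j i).const_mul _
  have hIi : ∀ i, IntervalIntegrable (fun r => ∑ j, X i j * controlledDrift U S D r j i)
      volume s t := fun i => by
    simpa only [Finset.sum_fn] using IntervalIntegrable.sum Finset.univ fun j _ => hIj i j
  have hInt : trace (X * (S t - S s)) = ∫ r in s..t, trace (X * controlledDrift U S D r) := by
    simp only [htr]
    rw [intervalIntegral.integral_finsetSum fun i _ => hIi i]
    refine Finset.sum_congr rfl fun i _ => ?_
    rw [intervalIntegral.integral_finsetSum fun j _ => hIj i j]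
    refine Finset.sum_congr rfl fun j _ => ?_
    rw [intervalIntegral.integral_const_mul, Matrix.sub_apply, h.increment s hs t ht]
  have hIt : IntervalIntegrable (fun r => trace (X * controlledDrift U S D r)) volume s t := by
    simp only [htr]
    simpa only [Finset.sum_fn] using IntervalIntegrable.sum Finset.univ fun i _ => hIi i
  rw [hInt]
  refine (intervalIntegral.integral_mono_on hst hIt intervalIntegrable_const hb).trans ?_
  rw [intervalIntegral.integral_const, smul_eq_mul, mul_comm]

theorem exists_step (h : IsControlledFlow U S D T) (hD : D.IsDiag) (hT : 0 ≤ T) {k : ℕ}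
    (hk : k ≤ n) {ε : ℝ} (hε : 0 < ε) :
    ∃ δ > 0, ∀ s ∈ Set.Icc 0 T, ∀ t ∈ Set.Icc 0 T, s ≤ t → t - s < δ →
      topSum k (logEigenvalues (S t)) - topSum k (logEigenvalues (S s)) ≤
        (2 * topSum k D.diag + ε) * (t - s) := by
  obtain ⟨C, hC, hbd, huc⟩ := h.exists_uniform_bounds hT
  obtain ⟨c, hc, htr⟩ := exists_abs_trace_le n
  have hK : 0 ≤ 3 * (c * C * ‖D‖) := by positivity
  set η := ε / (3 * (c * C * ‖D‖) + 1) with hη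
  have hηpos : 0 < η := by positivity
  have hηε : 3 * (c * C * ‖D‖) * η ≤ ε := by
    rw [hη, mul_div_assoc', div_le_iff₀ (by positivity)]
    nlinarith
  obtain ⟨δ, hδ, hclose⟩ := huc η hηpos
  refine ⟨δ, hδ, fun s hs t ht hst hlt => ?_⟩
  obtain ⟨V, I, hV, hI, hcomm, hV'⟩ := exists_spanProj_topSum_log_le hk (h.posDef t ht)
  refine (hV' (S s) (h.posDef s hs)).trans (h.trace_mul_sub_le hs ht hst _ fun r hr => ?_)
  have hrT : r ∈ Set.Icc 0 T := ⟨hs.1.trans hr.1, hr.2.trans ht.2⟩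
  have hrt : |r - t| < δ := by rw [abs_lt]; constructor <;> linarith [hr.1, hr.2]
  have hrs : |r - s| < δ := by rw [abs_lt]; constructor <;> linarith [hr.1, hr.2]
  have hts : |s - t| < δ := by rw [abs_lt]; constructor <;> linarith
  have hmain := trace_drift_le (A := U r * D * (U r)ᵀ) hc htr (h.posDef t ht).isUnit
    (h.posDef s hs).isUnit (norm_spanProj_le hV I) hcomm (hbd r hrT).1 (hbd t ht).2 (hbd s hs).2
    (hclose r hrT t ht hrt).1 (hclose r hrT s hs hrs).1 (hclose s hs t ht hts).2
  have hA : 3 * (c * C * ‖U r * D * (U r)ᵀ‖) * η ≤ 3 * (c * C * ‖D‖) * η := by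
    gcongr
    exact norm_conj_le (h.orthogonal r hrT) D
  have hKF : trace (spanProj V I * (U r * D * (U r)ᵀ)) ≤ topSum k D.diag := by
    have := trace_spanProj_mul_le hV (h.orthogonal r hrT) hI D.diag
    rwa [hD.diagonal_diag] at this
  rw [controlledDrift]
  linarith

theorem topSum_logEigenvalues_le (h : IsControlledFlow U S D T) (hD : D.IsDiag) (hT : 0 ≤ T)
    {k : ℕ} (hk : k ≤ n) :
    topSum k (logEigenvalues (S T)) ≤
      topSum k (logEigenvalues (S 0)) + 2 * T * topSum k D.diag := by
  refine le_of_forall_pos_le_add fun ε' hε' => ?_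
  set ε := ε' / (T + 1) with hεdef
  have hε : 0 < ε := by positivity
  have hεT : ε * T ≤ ε' := by
    rw [hεdef, div_mul_eq_mul_div, div_le_iff₀ (by positivity)]
    nlinarith
  obtain ⟨δ, hδ, hstep⟩ := h.exists_step hD hT hk hε
  obtain ⟨N, hN⟩ := exists_nat_gt (T / δ)
  have hN0 : (0 : ℝ) < N := (div_nonneg hT hδ.le).trans_lt hN
  have hmesh : T / N < δ := by
    rw [div_lt_iff₀ hδ] at hN
    rw [div_lt_iff₀ hN0]
    linarith
  have hmesh0 : 0 ≤ T / N := by positivity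
  have hNT : N * (T / N) = T := by field_simp
  have hind : ∀ m : ℕ, m ≤ N →
      topSum k (logEigenvalues (S (m * (T / N)))) - topSum k (logEigenvalues (S 0)) ≤
        (2 * topSum k D.diag + ε) * (m * (T / N)) := by
    intro m
    induction m with
    | zero => simp
    | succ m ih =>
      intro hm
      have hmem : ∀ l : ℕ, l ≤ N → (l * (T / N) : ℝ) ∈ Set.Icc 0 T := fun l hl => by
        refine ⟨by positivity, ?_⟩
        have : (l : ℝ) ≤ N := by exact_mod_cast hl
        calc l * (T / N) ≤ N * (T / N) := by gcongr
          _ = T := hNT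
      have h1 := ih (by omega)
      have h2 := hstep _ (hmem m (by omega)) _ (hmem (m + 1) hm)
        (by push_cast; linarith) (by push_cast; linarith)
      push_cast at h2 ⊢
      linarith
  have := hind N le_rfl
  rw [hNT] at this
  linarith

theorem reverse (h : IsControlledFlow U S D T) :
    IsControlledFlow (fun t => U (T - t)) (fun t => S (T - t)) (-D) T := by
  have hmem : ∀ t ∈ Set.Icc 0 T, T - t ∈ Set.Icc 0 T := fun t ht =>
    ⟨by linarith [ht.2], by linarith [ht.1]⟩
  have hdrift : ∀ t, controlledDrift (fun t => U (T - t)) (fun t => S (T - t)) (-D) t =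
      -controlledDrift U S D (T - t) := fun t => by
    simp only [controlledDrift, Matrix.mul_neg, Matrix.neg_mul]
    abel
  refine ⟨fun t ht => h.orthogonal _ (hmem t ht), fun t ht => h.posDef _ (hmem t ht),
    fun i j => ?_, fun s hs t ht i j => ?_⟩
  · simp only [hdrift, Matrix.neg_apply]
    have := ((h.integrable i j).comp_sub_left T).symm
    rw [sub_zero, sub_self] at this
    exact this.neg
  · simp only [hdrift, Matrix.neg_apply]
    rw [intervalIntegral.integral_neg,
      intervalIntegral.integral_comp_sub_left (fun r => controlledDrift U S D r i j) T,
      ← h.increment _ (hmem t ht) _ (hmem s hs)]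
    ring

end IsControlledFlow

theorem IsReachable.exists_isControlledFlow {n : ℕ} {P₀ PT D : Matrix (Fin n) (Fin n) ℝ} {T : ℝ}
    (h : IsReachable P₀ PT D T) :
    ∃ U S : ℝ → Matrix (Fin n) (Fin n) ℝ, IsControlledFlow U S D T ∧ S 0 = P₀ ∧ S T = PT := by
  obtain ⟨U, S, -, hU, hS, h0, hST, hint, heq⟩ := h
  refine ⟨U, S, ⟨hU, hS, hint, fun s hs t ht i j => ?_⟩, h0, hST⟩
  have hI : ∀ t ∈ Set.Icc 0 T,
      IntervalIntegrable (fun r => controlledDrift U S D r i j) volume 0 t := fun t ht =>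
    (hint i j).mono_set (by
      rw [Set.uIcc_of_le ht.1, Set.uIcc_of_le (ht.1.trans ht.2)]
      exact Set.Icc_subset_Icc le_rfl ht.2)
  rw [heq t ht, heq s hs, add_sub_add_left_eq_sub]
  exact intervalIntegral.integral_interval_sub_left (hI t ht) (hI s hs)

end Flow

/-- Theorem 4, necessity of log-majorization.
If `ΣT ∈ R(Σ₀, D, T)`, then `log λ(ΣT) ≺ log λ(Σ₀)↓ + 2T λ(D)↓`. -/
theorem log_eigenvalues_majorized_of_isReachable
    {n : ℕ} (hn : 1 ≤ n) (T : ℝ) (hT : 0 < T)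
    (D P₀ PT : Matrix (Fin n) (Fin n) ℝ) (hD : D.IsDiag)
    (hP₀ : P₀.PosDef) (hPT : PT.PosDef)
    (hreach : IsReachable P₀ PT D T) :
    IsMajorizedBy (fun i => Real.log (hPT.1.eigenvalues i))
      (fun i => sortDesc (fun j => Real.log (hP₀.1.eigenvalues j)) i
        + 2 * T * sortDesc D.diag i) := by
  obtain ⟨U, S, hflow, rfl, rfl⟩ := hreach.exists_isControlledFlow
  rw [← logEigenvalues_eq hPT.1, ← logEigenvalues_eq hP₀.1]
  have hdiag : (-D).diag = -D.diag := diag_neg D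
  have hupper := fun {k : ℕ} (hk : k ≤ n) => hflow.topSum_logEigenvalues_le hD hT.le hk
  refine ⟨?_, fun k hk => ?_⟩
  · have hlower := hflow.reverse.topSum_logEigenvalues_le hD.neg hT.le le_rfl
    have hupper_n := hupper le_rfl
    simp only [sub_self, sub_zero, topSum_self, hdiag, Pi.neg_apply, Finset.sum_neg_distrib]
      at hlower hupper_n
    rw [Finset.sum_add_distrib, ← Finset.mul_sum, sum_sortDesc, sum_sortDesc]
    linarith
  · refine (hupper hk.le).trans ?_
    refine le_trans (le_of_eq ?_) (sum_finset_le_topSum hk.le _ (card_filter_val_lt hk.le))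
    rw [Finset.sum_add_distrib, ← Finset.mul_sum]
    rfl
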